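/- Let d ≥ 1, let Σ be a symmetric positive definite real d×d matrix, let σ_f ∈ ℝ, σ_l > 0, and let z_q ∈ ℝ^d. Then ∫_{ℝ^d} σ_f² exp(-‖z_q - z‖²/(2σ_l²)) dN(0,Σ)(z) = σ_f² σ_l^d · exp(-(1/2) z_qᵀ (Σ + σ_l² I_d)⁻¹ z_q) / √(det(Σ + σ_l² I_d)), where I_d denotes the d×d identity matrix. -/

import Mathlib

open MeasureTheory Real Matrix

/-- The multivariate Gaussian probability measure on `ι → ℝ` with mean `μ` and covariance
matrix `S`: for `S` symmetric positive definite, its density with respect to the Lebesgue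
measure is `z ↦ (2π)^(-d/2) det(S)^(-1/2) exp(-(1/2)(z-μ)ᵀ S⁻¹ (z-μ))`. -/
noncomputable def mvGaussian {ι : Type*} [Fintype ι] [DecidableEq ι]
    (μ : ι → ℝ) (S : Matrix ι ι ℝ) : Measure (ι → ℝ) :=
  (volume : Measure (ι → ℝ)).withDensity fun z =>
    ENNReal.ofReal ((2 * π) ^ (-(Fintype.card ι : ℝ) / 2) * S.det ^ (-(1 : ℝ) / 2) *
      Real.exp (-(1 / 2) * ((z - μ) ⬝ᵥ S⁻¹.mulVec (z - μ))))

open scoped MatrixOrder in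
theorem exists_factor {d : ℕ} {P : Matrix (Fin d) (Fin d) ℝ} (hP : P.PosDef) :
    ∃ B : Matrix (Fin d) (Fin d) ℝ, IsUnit B ∧ P = Bᵀ * B := by
  have h := ((CStarAlgebra.isStrictlyPositive_TFAE (a := P)).out 0 5).1
    (Matrix.isStrictlyPositive_iff_posDef.2 hP)
  obtain ⟨B, hB, h⟩ := h
  exact ⟨B, hB, by simpa [star_eq_conjTranspose] using h⟩

theorem integral_std (d : ℕ) :
    ∫ z : Fin d → ℝ, Real.exp (-(1 / 2) * (z ⬝ᵥ z)) = √(2 * π) ^ d := by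
  have h := integral_fintype_prod_volume_eq_prod (𝕜 := ℝ) (ι := Fin d) (E := fun _ => ℝ)
    (fun _ x => Real.exp (-(1 / 2) * x ^ 2))
  simp only [integral_gaussian, Finset.prod_const, Finset.card_univ, Fintype.card_fin] at h
  rw [show 2 * π = π / (1 / 2) by ring, ← h]
  congr 1
  ext z
  rw [← Real.exp_sum, ← Finset.mul_sum]
  simp [dotProduct, sq]

theorem integral_posDef {d : ℕ} {P : Matrix (Fin d) (Fin d) ℝ} (hP : P.PosDef) :
    ∫ z : Fin d → ℝ, Real.exp (-(1 / 2) * (z ⬝ᵥ P *ᵥ z)) = √(2 * π) ^ d / √P.det := by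
  obtain ⟨B, hB, rfl⟩ := exists_factor hP
  have hdet : B.det ≠ 0 := ((Matrix.isUnit_iff_isUnit_det B).1 hB).ne_zero
  have hm := Real.map_matrix_volume_pi_eq_smul_volume_pi hdet
  have h1 : ∫ z, Real.exp (-(1 / 2) * (z ⬝ᵥ z)) ∂(Measure.map (toLin' B) volume)
      = ∫ z : Fin d → ℝ, Real.exp (-(1 / 2) * (z ⬝ᵥ (Bᵀ * B) *ᵥ z)) := by
    rw [integral_map]
    · congr 1
      ext z
      rw [toLin'_apply, ← mulVec_mulVec, dotProduct_mulVec z, vecMul_transpose]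
    · exact (LinearMap.continuous_of_finiteDimensional _).aemeasurable
    · apply Continuous.aestronglyMeasurable
      simp only [dotProduct]
      fun_prop
  rw [← h1, hm, integral_smul_measure, integral_std]
  rw [ENNReal.toReal_ofReal (abs_nonneg _), det_mul, det_transpose, Real.sqrt_mul_self_eq_abs,
    abs_inv, smul_eq_mul]
  field_simp

/-- Integration of the squared exponential kernel `z ↦ σf² exp(-‖z_q - z‖²/(2σl²))`
against the centered multivariate Gaussian with covariance `S`. -/
theorem integral_SE_kernel_mvGaussian
    (d : ℕ) (hd : 1 ≤ d) (S : Matrix (Fin d) (Fin d) ℝ) (hS : S.PosDef)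
    (σf σl : ℝ) (hσl : 0 < σl) (zq : Fin d → ℝ) :
    ∫ z, σf ^ 2 * Real.exp (-(∑ i, (zq i - z i) ^ 2) / (2 * σl ^ 2)) ∂(mvGaussian 0 S)
    = σf ^ 2 * σl ^ d *
        Real.exp (-(1 / 2) *
          (zq ⬝ᵥ (S + σl ^ 2 • (1 : Matrix (Fin d) (Fin d) ℝ))⁻¹.mulVec zq)) /
        Real.sqrt (S + σl ^ 2 • (1 : Matrix (Fin d) (Fin d) ℝ)).det := by
  set T := S + σl ^ 2 • (1 : Matrix (Fin d) (Fin d) ℝ) with hTdef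
  have hσ2 : 0 < σl ^ 2 := by positivity
  have hT : T.PosDef := hS.add (PosDef.one.smul hσ2)
  set a : ℝ := (σl ^ 2)⁻¹ with ha
  have ha0 : 0 < a := by positivity
  have haσ : a * σl ^ 2 = 1 := by rw [ha]; field_simp
  set P := S⁻¹ + a • (1 : Matrix (Fin d) (Fin d) ℝ) with hPdef
  have hP : P.PosDef := hS.inv.add (PosDef.one.smul ha0)
  have hSdet : 0 < S.det := hS.det_pos
  have hTdet : 0 < T.det := hT.det_pos
  have hSu : IsUnit S.det := hSdet.ne'.isUnit
  have hTu : IsUnit T.det := hTdet.ne'.isUnit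
  have hPT : P = a • (S⁻¹ * T) := by
    rw [hPdef, hTdef, mul_add, nonsing_inv_mul _ hSu, smul_add, Matrix.mul_smul, mul_one, smul_smul,
      haσ, one_smul, add_comm]
  have hPdet : P.det = a ^ d * (S.det⁻¹ * T.det) := by
    rw [hPT, det_smul, det_mul, det_nonsing_inv, Fintype.card_fin, Ring.inverse_eq_inv]
  set m : Fin d → ℝ := T⁻¹ *ᵥ (S *ᵥ zq) with hm
  have hPm : P *ᵥ m = a • zq := by
    rw [hPT, hm, smul_mulVec, mulVec_mulVec, mulVec_mulVec]
    rw [mul_assoc S⁻¹, mul_nonsing_inv _ hTu, mul_one, nonsing_inv_mul _ hSu, one_mulVec]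
  have hmz : zq - m = σl ^ 2 • (T⁻¹ *ᵥ zq) := by
    have : zq = T⁻¹ *ᵥ (T *ᵥ zq) := by
      rw [mulVec_mulVec, nonsing_inv_mul _ hTu, one_mulVec]
    have h2 : T *ᵥ zq = S *ᵥ zq + σl ^ 2 • zq := by
      rw [hTdef, add_mulVec, smul_mulVec, one_mulVec]
    nth_rewrite 1 [this]
    rw [h2, mulVec_add, mulVec_smul, hm]
    abel
  have hPsymm : Pᵀ = P := by simpa using hP.1.eq
  have hmP (z : Fin d → ℝ) : m ⬝ᵥ P *ᵥ z = a * (zq ⬝ᵥ z) := by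
    rw [dotProduct_mulVec, ← mulVec_transpose, hPsymm, hPm, smul_dotProduct, smul_eq_mul]
  have hzPz (z : Fin d → ℝ) : z ⬝ᵥ P *ᵥ z = z ⬝ᵥ S⁻¹ *ᵥ z + a * (z ⬝ᵥ z) := by
    rw [hPdef, add_mulVec, smul_mulVec, one_mulVec, dotProduct_add, dotProduct_smul, smul_eq_mul]
  have hc : a * (zq ⬝ᵥ zq) - a * (zq ⬝ᵥ m) = zq ⬝ᵥ T⁻¹ *ᵥ zq := by
    rw [← mul_sub, ← dotProduct_sub, hmz, dotProduct_smul, smul_eq_mul, ← mul_assoc, haσ, one_mul]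
  have hsq (z : Fin d → ℝ) : ∑ i, (zq i - z i) ^ 2 = zq ⬝ᵥ zq - 2 * (zq ⬝ᵥ z) + z ⬝ᵥ z := by
    simp only [dotProduct, Finset.mul_sum, ← Finset.sum_sub_distrib, ← Finset.sum_add_distrib]
    exact Finset.sum_congr rfl fun i _ => by ring
  have key (z : Fin d → ℝ) : -(1 / 2) * (z ⬝ᵥ S⁻¹ *ᵥ z) + -(∑ i, (zq i - z i) ^ 2) / (2 * σl ^ 2)
      = -(1 / 2) * (zq ⬝ᵥ T⁻¹ *ᵥ zq) + -(1 / 2) * ((z - m) ⬝ᵥ P *ᵥ (z - m)) := by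
    have e : (z - m) ⬝ᵥ P *ᵥ (z - m)
        = z ⬝ᵥ S⁻¹ *ᵥ z + a * (z ⬝ᵥ z) - 2 * a * (zq ⬝ᵥ z) + a * (zq ⬝ᵥ m) := by
      rw [mulVec_sub, sub_dotProduct, dotProduct_sub, dotProduct_sub, hmP, hmP, hPm, hzPz,
        dotProduct_smul, smul_eq_mul, dotProduct_comm z zq]
      ring
    have e2 : -(∑ i, (zq i - z i) ^ 2) / (2 * σl ^ 2)
        = -(1 / 2) * (a * (∑ i, (zq i - z i) ^ 2)) := by
      rw [ha]; field_simp
    rw [e, e2, hsq, ← hc]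
    ring
  have hC : 0 ≤ (2 * π) ^ (-(d : ℝ) / 2) * S.det ^ (-(1 : ℝ) / 2) := by positivity
  rw [mvGaussian, integral_withDensity_eq_integral_toReal_smul]
  rotate_left
  · apply Measurable.ennreal_ofReal
    apply Continuous.measurable
    simp only [dotProduct, mulVec]
    fun_prop
  · exact Filter.Eventually.of_forall fun _ => ENNReal.ofReal_lt_top
  have hint : ∀ z : Fin d → ℝ,
      (ENNReal.ofReal ((2 * π) ^ (-(Fintype.card (Fin d) : ℝ) / 2) * S.det ^ (-(1 : ℝ) / 2) *
      Real.exp (-(1 / 2) * ((z - 0) ⬝ᵥ S⁻¹.mulVec (z - 0))))).toReal •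
        (σf ^ 2 * Real.exp (-(∑ i, (zq i - z i) ^ 2) / (2 * σl ^ 2)))
      = ((2 * π) ^ (-(d : ℝ) / 2) * S.det ^ (-(1 : ℝ) / 2) * σf ^ 2 *
          Real.exp (-(1 / 2) * (zq ⬝ᵥ T⁻¹ *ᵥ zq))) *
          Real.exp (-(1 / 2) * ((z - m) ⬝ᵥ P *ᵥ (z - m))) := by
    intro z
    rw [Fintype.card_fin, ENNReal.toReal_ofReal (mul_nonneg hC (Real.exp_pos _).le), sub_zero,
      smul_eq_mul]
    have k := congrArg Real.exp (key z)
    rw [Real.exp_add, Real.exp_add] at k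
    linear_combination ((2 * π) ^ (-(d : ℝ) / 2) * S.det ^ (-(1 : ℝ) / 2) * σf ^ 2) * k
  simp_rw [hint]
  rw [integral_const_mul,
    integral_sub_right_eq_self (fun z => Real.exp (-(1 / 2) * (z ⬝ᵥ P *ᵥ z))) m,
    integral_posDef hP]
  have h2π : (2 * π) ^ (-(d : ℝ) / 2) * √(2 * π) ^ d = 1 := by
    rw [Real.sqrt_eq_rpow, ← Real.rpow_natCast, ← Real.rpow_mul (by positivity),
      ← Real.rpow_add (by positivity)]
    ring_nf
    exact Real.rpow_zero _
  have hSd : S.det ^ (-(1 : ℝ) / 2) = (√S.det)⁻¹ := by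
    rw [Real.sqrt_eq_rpow, ← Real.rpow_neg hSdet.le]
    norm_num
  have hPd : √P.det = (σl ^ d)⁻¹ * ((√S.det)⁻¹ * √T.det) := by
    rw [hPdet, Real.sqrt_mul (by positivity), Real.sqrt_mul (by positivity), Real.sqrt_inv]
    congr 1
    rw [ha, show ((σl ^ 2)⁻¹) ^ d = ((σl ^ d)⁻¹) ^ 2 by
      rw [inv_pow, inv_pow, ← pow_mul, ← pow_mul, mul_comm]]
    exact Real.sqrt_sq (by positivity)
  have hs : 0 < √S.det := Real.sqrt_pos.2 hSdet
  have ht : 0 < √T.det := Real.sqrt_pos.2 hTdet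
  rw [hSd, hPd]
  have hs' := hs.ne'
  have ht' := ht.ne'
  have hl : σl ^ d ≠ 0 := by positivity
  calc _ = ((2 * π) ^ (-(d : ℝ) / 2) * √(2 * π) ^ d) * (σf ^ 2 * σl ^ d *
        Real.exp (-(1 / 2) * (zq ⬝ᵥ T⁻¹ *ᵥ zq)) / √T.det) := by
        generalize (2 * π) ^ (-(d : ℝ) / 2) = u
        generalize Real.exp (-(1 / 2) * (zq ⬝ᵥ T⁻¹ *ᵥ zq)) = v
        generalize √(2 * π) ^ d = w
        field_simp
    _ = _ := by rw [h2π, one_mul]
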